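/- (Weyl law from a smoothed trace asymptotic) Let (λ_j) be a nondecreasing sequence of nonnegative reals tending to infinity. Suppose there is a constant V > 0 such that for every χ ∈ C_c^∞((0,∞)) with χ ≥ 0, ∑_j χ((λ_j/R)²) = V R^n ∫_{ℝⁿ} χ(|ξ|²) dξ · (2π)^{-n} + o(R^n) as R → ∞. Then #{j : λ_j ≤ R} = (2π)^{-n} V ω_n R^n + o(R^n), where ω_n is the volume of the unit ball in ℝⁿ. -/

import Mathlib

open Filter MeasureTheory
open scoped Real

lemma aux_rec (e : ℝ → ℝ) (q : ℝ) (hq0 : 0 ≤ q) (hq : q ≤ 1 / 2)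
    (hg : Tendsto (fun R => e R - q * e (R / 2)) atTop (nhds 0))
    (hb : ∀ R0 : ℝ, 0 < R0 → ∃ B, ∀ R, R0 / 2 ≤ R → R ≤ R0 → |e R| ≤ B) :
    Tendsto e atTop (nhds 0) := by
  rw [Metric.tendsto_atTop] at hg ⊢
  intro δ' hδ'
  obtain ⟨δ, hδ, rfl⟩ : ∃ δ, 0 < δ ∧ δ' = 4 * δ := ⟨δ' / 4, by positivity, by ring⟩
  obtain ⟨R1, hR1⟩ := hg δ hδ
  set R0 := max R1 1 with hR0
  have hR0pos : 0 < R0 := lt_of_lt_of_le one_pos (le_max_right _ _)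
  have hstep : ∀ R, R0 ≤ R → |e R| ≤ δ + 1 / 2 * |e (R / 2)| := by
    intro R hR
    have h1 := hR1 R (le_trans (le_max_left _ _) hR)
    rw [Real.dist_eq, sub_zero] at h1
    have h2 : |e R| ≤ |e R - q * e (R / 2)| + |q * e (R / 2)| := by
      have := abs_add_le (e R - q * e (R / 2)) (q * e (R / 2))
      simpa using this
    have h3 : |q * e (R / 2)| ≤ 1 / 2 * |e (R / 2)| := by
      rw [abs_mul, abs_of_nonneg hq0]
      gcongr
    linarith
  obtain ⟨B, hB⟩ := hb R0 hR0pos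
  have hclaim : ∀ k : ℕ, ∀ R, R0 * 2 ^ k / 2 ≤ R → R ≤ R0 * 2 ^ k → |e R| ≤ 2 * δ + B / 2 ^ k := by
    intro k
    induction k with
    | zero =>
      intro R h1 h2
      have := hB R (by simpa using h1) (by simpa using h2)
      simp
      linarith
    | succ k ih =>
      intro R h1 h2
      rw [pow_succ] at h1 h2 ⊢
      have hk : (1 : ℝ) ≤ 2 ^ k := one_le_pow₀ (by norm_num)
      have h3 := ih (R / 2) (by linarith) (by linarith)
      have h4 := hstep R (by nlinarith)
      have h5 : B / (2 ^ k * 2) = 1 / 2 * (B / 2 ^ k) := by field_simp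
      rw [h5]
      linarith
  obtain ⟨K, hK⟩ := pow_unbounded_of_one_lt (B / δ) (one_lt_two : (1 : ℝ) < 2)
  refine ⟨R0 * 2 ^ K, fun R hR => ?_⟩
  have hx : (2 : ℝ) ^ K ≤ R / R0 := by
    rw [le_div_iff₀ hR0pos]; linarith
  have hx1 : 1 ≤ R / R0 := le_trans (one_le_pow₀ (by norm_num)) hx
  obtain ⟨m, hm1, hm2⟩ := exists_nat_pow_near hx1 (one_lt_two : (1 : ℝ) < 2)
  have hle : (2 : ℝ) ^ K ≤ 2 ^ (m + 1) := hx.trans hm2.le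
  have h6 := hclaim (m + 1) R (by
      rw [le_div_iff₀ hR0pos] at hm1
      rw [pow_succ]; linarith) (by
      rw [div_lt_iff₀ hR0pos] at hm2
      linarith)
  have h7 : B / 2 ^ (m + 1) ≤ δ := by
    rw [div_le_iff₀ (by positivity)]
    rw [div_lt_iff₀ hδ] at hK
    nlinarith
  rw [Real.dist_eq, sub_zero]
  linarith

lemma aux_vol (n : ℕ) (hn : 1 ≤ n) (a b : ℝ) (ha : 0 ≤ a) (hab : a ≤ b) :
    IntegrableOn (fun _ => (1 : ℝ)) (Metric.closedBall (0 : EuclideanSpace ℝ (Fin n)) b \ Metric.ball 0 a) volume ∧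
    (∫ ξ : EuclideanSpace ℝ (Fin n), (Metric.closedBall (0 : EuclideanSpace ℝ (Fin n)) b \ Metric.ball 0 a).indicator (fun _ => (1 : ℝ)) ξ)
     = (volume (Metric.ball (0 : EuclideanSpace ℝ (Fin n)) 1)).toReal * (b ^ n - a ^ n) := by
  haveI : Nonempty (Fin n) := ⟨⟨0, hn⟩⟩
  have hb := ha.trans hab
  have hfin : volume (Metric.closedBall (0 : EuclideanSpace ℝ (Fin n)) b \ Metric.ball 0 a) ≠ ⊤ :=
    ((measure_mono Set.diff_subset).trans_lt measure_closedBall_lt_top).ne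
  refine ⟨integrableOn_const hfin, ?_⟩
  rw [integral_indicator (measurableSet_closedBall.diff measurableSet_ball), setIntegral_const,
    measureReal_sdiff (Metric.ball_subset_closedBall.trans (Metric.closedBall_subset_closedBall hab)) measurableSet_ball measure_closedBall_lt_top.ne]
  simp only [measureReal_def]
  rw [Measure.addHaar_closedBall _ _ hb, Measure.addHaar_ball _ _ ha]
  simp [ENNReal.toReal_mul, ENNReal.toReal_ofReal, pow_nonneg, ha, hb]
  ring

lemma aux_upper (n : ℕ) (hn : 1 ≤ n) (χ : ℝ → ℝ) (a b : ℝ) (ha : 0 ≤ a) (hab : a ≤ b)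
    (h0 : ∀ s, 0 ≤ χ s) (h1 : ∀ s, χ s ≤ 1) (hs : ∀ s, χ s ≠ 0 → a < s ∧ s < b) :
    (∫ ξ : EuclideanSpace ℝ (Fin n), χ (‖ξ‖ ^ 2)) ≤
      (volume (Metric.ball (0 : EuclideanSpace ℝ (Fin n)) 1)).toReal * (√b ^ n - √a ^ n) := by
  obtain ⟨hi, he⟩ := aux_vol n hn (√a) (√b) (Real.sqrt_nonneg _) (Real.sqrt_le_sqrt hab)
  rw [← he]
  refine integral_mono_of_nonneg (Eventually.of_forall fun _ => h0 _)
    (hi.integrable_indicator (measurableSet_closedBall.diff measurableSet_ball))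
    (Eventually.of_forall fun ξ => ?_)
  by_cases hx : χ (‖ξ‖ ^ 2) = 0
  · simp only [hx]
    exact Set.indicator_nonneg (fun _ _ => zero_le_one) _
  · obtain ⟨h2, h3⟩ := hs _ hx
    have : ξ ∈ Metric.closedBall (0 : EuclideanSpace ℝ (Fin n)) (√b) \ Metric.ball 0 (√a) := by
      simp only [Set.mem_diff, mem_closedBall_zero_iff, mem_ball_zero_iff, not_lt]
      exact ⟨Real.le_sqrt_of_sq_le h3.le, Real.sqrt_le_iff.2 ⟨norm_nonneg _, h2.le⟩⟩
    simp only [Set.indicator_of_mem this]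
    exact h1 _

lemma aux_lower (n : ℕ) (hn : 1 ≤ n) (χ : ℝ → ℝ) (a b : ℝ) (ha : 0 ≤ a) (hab : a ≤ b)
    (hc : Continuous χ)
    (h0 : ∀ s, 0 ≤ χ s) (h1 : ∀ s, a ≤ s → s ≤ b → χ s = 1) (hs : ∀ s, χ s ≠ 0 → s ≤ 1) :
      (volume (Metric.ball (0 : EuclideanSpace ℝ (Fin n)) 1)).toReal * (√b ^ n - √a ^ n) ≤
    (∫ ξ : EuclideanSpace ℝ (Fin n), χ (‖ξ‖ ^ 2)) := by
  obtain ⟨hi, he⟩ := aux_vol n hn (√a) (√b) (Real.sqrt_nonneg _) (Real.sqrt_le_sqrt hab)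
  rw [← he]
  refine integral_mono_of_nonneg
    (Eventually.of_forall fun _ => Set.indicator_nonneg (fun _ _ => zero_le_one) _)
    (Continuous.integrable_of_hasCompactSupport (by fun_prop) ?_)
    (Eventually.of_forall fun ξ => ?_)
  · refine HasCompactSupport.intro (isCompact_closedBall 0 1) fun ξ hξ => ?_
    by_contra h
    have := hs _ h
    simp only [mem_closedBall_zero_iff, not_le] at hξ
    nlinarith
  · by_cases hx : ξ ∈ Metric.closedBall (0 : EuclideanSpace ℝ (Fin n)) (√b) \ Metric.ball 0 (√a)
    · simp only [Set.indicator_of_mem hx]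
      simp only [Set.mem_diff, mem_closedBall_zero_iff, mem_ball_zero_iff, not_lt] at hx
      rw [h1]
      · exact (Real.sqrt_le_iff.1 hx.2).2
      · exact (Real.le_sqrt (norm_nonneg _) (ha.trans hab)).1 hx.1
    · simp only [Set.indicator_of_notMem hx]
      exact h0 _

lemma aux_fin (lam : ℕ → ℝ) (hinf : Tendsto lam atTop atTop) (R : ℝ) :
    {j : ℕ | lam j ≤ R}.Finite := by
  have := hinf.eventually_gt_atTop R
  rw [← Nat.cofinite_eq_atTop, eventually_cofinite] at this
  simpa using this

/-- counting difference as a finite sum -/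
lemma aux_count (lam : ℕ → ℝ) (hinf : Tendsto lam atTop atTop) (R : ℝ) (hR : 0 < R) :
    (Nat.card {j : ℕ | lam j ≤ R} : ℝ) - (Nat.card {j : ℕ | lam j ≤ R / 2} : ℝ)
      = ∑ j ∈ (aux_fin lam hinf (2 * R)).toFinset, if R / 2 < lam j ∧ lam j ≤ R then (1 : ℝ) else 0 := by
  classical
  have key : ∀ S, S ≤ 2 * R → (Nat.card {j : ℕ | lam j ≤ S} : ℝ) =
      ∑ j ∈ (aux_fin lam hinf (2 * R)).toFinset, if lam j ≤ S then (1 : ℝ) else 0 := by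
    intro S hS
    rw [Finset.sum_boole, Nat.card_coe_set_eq, ← Set.ncard_coe_finset]
    congr 2
    ext j
    simp
    intro h; linarith
  rw [key R (by linarith), key (R / 2) (by linarith), ← Finset.sum_sub_distrib]
  refine Finset.sum_congr rfl fun j _ => ?_
  by_cases h1 : lam j ≤ R / 2
  · have : lam j ≤ R := by linarith
    simp [h1, this]
  · push Not at h1
    by_cases h2 : lam j ≤ R
    · simp [h1, h2]
    · simp [h1, h2]

lemma aux_tsum (lam : ℕ → ℝ) (hpos : ∀ j, 0 ≤ lam j) (hinf : Tendsto lam atTop atTop) (R : ℝ) (hR : 0 < R)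
    (χ : ℝ → ℝ) (hs : ∀ s, χ s ≠ 0 → s ≤ 4) :
    (∑' j : ℕ, χ ((lam j / R) ^ 2)) = ∑ j ∈ (aux_fin lam hinf (2 * R)).toFinset, χ ((lam j / R) ^ 2) := by
  refine tsum_eq_sum fun j hj => ?_
  by_contra h
  have h1 := hs _ h
  apply hj
  simp only [Set.Finite.mem_toFinset, Set.mem_setOf_eq]
  have h2 : lam j / R ≤ 2 := by
    have := hpos j
    have : 0 ≤ lam j / R := by positivity
    nlinarith
  rwa [div_le_iff₀ hR] at h2

lemma aux_bump (r r' : ℝ) (h0 : 0 < r) (h : r < r') : ∃ χ : ℝ → ℝ,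
    ContDiff ℝ (⊤ : ℕ∞) χ ∧ HasCompactSupport χ ∧ (∀ s, 0 ≤ χ s) ∧ (∀ s, χ s ≤ 1) ∧
    (∀ s, 5 / 8 - r ≤ s → s ≤ 5 / 8 + r → χ s = 1) ∧
    (∀ s, χ s ≠ 0 → 5 / 8 - r' < s ∧ s < 5 / 8 + r') := by
  let f : ContDiffBump (5 / 8 : ℝ) := ⟨r, r', h0, h⟩
  refine ⟨f, f.contDiff, f.hasCompactSupport, fun s => f.nonneg, fun s => f.le_one, ?_, ?_⟩
  · intro s h1 h2
    apply f.one_of_mem_closedBall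
    rw [Real.closedBall_eq_Icc]
    exact ⟨h1, h2⟩
  · intro s hs
    have : s ∈ Function.support f := hs
    rw [f.support_eq, Real.ball_eq_Ioo] at this
    exact this

lemma aux_trace {S : ℝ → ℝ} {V P I : ℝ} {n : ℕ}
    (h : Tendsto (fun R : ℝ => (S R - V * R ^ n * P * I) / R ^ n) atTop (nhds 0)) :
    Tendsto (fun R : ℝ => S R / R ^ n) atTop (nhds (P * V * I)) := by
  have := h.add_const (P * V * I)
  rw [zero_add] at this
  refine this.congr' ?_
  filter_upwards [eventually_gt_atTop 0] with R hR
  field_simp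
  ring

lemma aux_phi (n : ℕ) (C : ℝ) :
    Tendsto (fun ε : ℝ => C * (√(1 + ε) ^ n - √(1 / 4 - ε) ^ n)) (nhds 0) (nhds (C * (1 - (1 / 2) ^ n))) := by
  have h : Continuous (fun ε : ℝ => C * (√(1 + ε) ^ n - √(1 / 4 - ε) ^ n)) := by fun_prop
  have h2 := h.tendsto 0
  have h3 : √(1 / 4 : ℝ) = 1 / 2 := by
    rw [show (1 / 4 : ℝ) = (1 / 2) ^ 2 by norm_num]
    exact Real.sqrt_sq (by norm_num)
  simpa only [add_zero, sub_zero, Real.sqrt_one, one_pow, h3] using h2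

/-- Weyl law from a smoothed trace asymptotic: if
`∑_j χ((λ_j/R)²) = (2π)⁻ⁿ V Rⁿ ∫_{ℝⁿ} χ(|ξ|²) dξ + o(Rⁿ)` for every
nonnegative `χ ∈ C_c^∞((0,∞))`, then
`#{j : λ_j ≤ R} = (2π)⁻ⁿ V ωₙ Rⁿ + o(Rⁿ)` where `ωₙ` is the volume of the
unit ball in `ℝⁿ`. -/
theorem stmt_7 (n : ℕ) (hn : 1 ≤ n)
    (lam : ℕ → ℝ) (hpos : ∀ j, 0 ≤ lam j) (hmono : Monotone lam)
    (hinf : Tendsto lam atTop atTop)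
    (V : ℝ) (hV : 0 < V)
    (htrace : ∀ χ : ℝ → ℝ, ContDiff ℝ (⊤ : ℕ∞) χ → HasCompactSupport χ →
      Function.support χ ⊆ Set.Ioi 0 → (∀ s, 0 ≤ χ s) →
      Tendsto (fun R : ℝ =>
          ((∑' j : ℕ, χ ((lam j / R) ^ 2))
            - V * R ^ n * (2 * π) ^ (-(n:ℤ)) *
              ∫ ξ : EuclideanSpace ℝ (Fin n), χ (‖ξ‖ ^ 2)) / R ^ n)
        atTop (nhds 0)) :
    Tendsto (fun R : ℝ =>
        ((Nat.card {j : ℕ | lam j ≤ R} : ℝ)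
          - (2 * π) ^ (-(n:ℤ)) * V *
            (volume (Metric.ball (0 : EuclideanSpace ℝ (Fin n)) 1)).toReal * R ^ n)
          / R ^ n)
      atTop (nhds 0) := by
  set P : ℝ := (2 * π) ^ (-(n:ℤ)) with hP
  have hPpos : 0 < P := by positivity
  set ω : ℝ := (volume (Metric.ball (0 : EuclideanSpace ℝ (Fin n)) 1)).toReal with hω
  set N : ℝ → ℝ := fun R => (Nat.card {j : ℕ | lam j ≤ R} : ℝ) with hN
  -- the dyadic annulus asymptotic
  have hdy : Tendsto (fun R => (N R - N (R / 2)) / R ^ n) atTop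
      (nhds (P * V * ω * (1 - (1 / 2) ^ n))) := by
    rw [tendsto_order]
    constructor
    · intro a ha
      have h1 := (aux_phi n (P * V * ω)).eventually (lt_mem_nhds ha)
      obtain ⟨δ, hδ, hball⟩ := Metric.eventually_nhds_iff.1 h1
      obtain ⟨ε, hε0, hεδ, hε4⟩ : ∃ ε : ℝ, 0 < ε ∧ ε < δ ∧ ε < 1 / 8 :=
        ⟨min δ (1 / 8) / 2, by positivity, by
          have := min_le_left δ (1 / 8); linarith, by
          have := min_le_right δ (1 / 8); linarith⟩
      have h2 := @hball (-ε) (by simpa [abs_of_pos hε0] using hεδ)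
      obtain ⟨χ, c1, c2, c3, c4, c5, c6⟩ := aux_bump (3 / 8 - ε) (3 / 8) (by linarith) (by linarith)
      have h3 := aux_trace (htrace χ c1 c2 (fun s hs => by
        have := (c6 s hs).1
        simp only [Set.mem_Ioi]; linarith) c3)
      have h4 := aux_lower n hn χ (1 / 4 - -ε) (1 + -ε) (by linarith) (by linarith) c1.continuous c3
        (fun s hs1 hs2 => c5 s (by linarith) (by linarith))
        (fun s hs => by have := (c6 s hs).2; linarith)
      have h5 : a < P * V * ∫ ξ : EuclideanSpace ℝ (Fin n), χ (‖ξ‖ ^ 2) := by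
        refine h2.trans_le ?_
        rw [mul_assoc (P * V)]
        gcongr
      filter_upwards [h3.eventually (lt_mem_nhds h5), eventually_gt_atTop 0] with R hR hR0
      refine hR.trans_le ?_
      gcongr
      rw [hN]
      simp only
      rw [aux_count lam hinf R hR0, aux_tsum lam hpos hinf R hR0 χ
        (fun s hs => by have := (c6 s hs).2; linarith)]
      refine Finset.sum_le_sum fun j _ => ?_
      split_ifs with hj
      · exact c4 _
      · by_contra hc
        apply hj
        obtain ⟨k1, k2⟩ := c6 _ (not_le.1 hc).ne'
        have hl : 0 ≤ lam j / R := div_nonneg (hpos j) hR0.le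
        have k3 : 1 / 2 < lam j / R := by nlinarith
        have k4 : lam j / R ≤ 1 := by nlinarith
        rw [lt_div_iff₀ hR0] at k3
        rw [div_le_iff₀ hR0] at k4
        constructor <;> linarith
    · intro a ha
      have h1 := (aux_phi n (P * V * ω)).eventually (gt_mem_nhds ha)
      obtain ⟨δ, hδ, hball⟩ := Metric.eventually_nhds_iff.1 h1
      obtain ⟨ε, hε0, hεδ, hε4⟩ : ∃ ε : ℝ, 0 < ε ∧ ε < δ ∧ ε < 1 / 8 :=
        ⟨min δ (1 / 8) / 2, by positivity, by
          have := min_le_left δ (1 / 8); linarith, by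
          have := min_le_right δ (1 / 8); linarith⟩
      have h2 := @hball ε (by simpa [abs_of_pos hε0] using hεδ)
      obtain ⟨χ, c1, c2, c3, c4, c5, c6⟩ := aux_bump (3 / 8) (3 / 8 + ε) (by linarith) (by linarith)
      have h3 := aux_trace (htrace χ c1 c2 (fun s hs => by
        have := (c6 s hs).1
        simp only [Set.mem_Ioi]; linarith) c3)
      have h4 := aux_upper n hn χ (1 / 4 - ε) (1 + ε) (by linarith) (by linarith) c3 c4
        (fun s hs => by have := c6 s hs; constructor <;> linarith [this.1, this.2])
      have h5 : P * V * ∫ ξ : EuclideanSpace ℝ (Fin n), χ (‖ξ‖ ^ 2) < a := by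
        refine lt_of_le_of_lt ?_ h2
        rw [mul_assoc (P * V)]
        gcongr
      filter_upwards [h3.eventually (gt_mem_nhds h5), eventually_gt_atTop 0] with R hR hR0
      refine lt_of_le_of_lt ?_ hR
      gcongr
      rw [hN]
      simp only
      rw [aux_count lam hinf R hR0, aux_tsum lam hpos hinf R hR0 χ
        (fun s hs => by have := (c6 s hs).2; linarith)]
      refine Finset.sum_le_sum fun j _ => ?_
      split_ifs with hj
      · have k3 : 1 / 2 < lam j / R := by rw [lt_div_iff₀ hR0]; linarith [hj.1]
        have k4 : lam j / R ≤ 1 := by rw [div_le_iff₀ hR0]; linarith [hj.2]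
        rw [c5 _ (by nlinarith) (by nlinarith)]
      · exact c3 _
  -- the recursion
  apply aux_rec _ ((1 / 2) ^ n) (by positivity) (by
    calc ((1 : ℝ) / 2) ^ n ≤ (1 / 2) ^ 1 := pow_le_pow_of_le_one (by norm_num) (by norm_num) hn
      _ = 1 / 2 := by norm_num)
  · have := hdy.sub_const (P * V * ω * (1 - (1 / 2) ^ n))
    rw [sub_self] at this
    refine this.congr' ?_
    filter_upwards [eventually_gt_atTop 0] with R hR
    change _ = (N R - _) / _ - _ * ((N (R / 2) - _) / _)
    rw [div_pow, div_pow, one_pow]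
    field_simp
    ring
  · intro R0 hR0
    refine ⟨(N R0 + P * V * ω * R0 ^ n) / (R0 / 2) ^ n, fun R h1 h2 => ?_⟩
    have hRpos : 0 < R := by linarith
    change |(N R - _) / _| ≤ _
    rw [abs_div, abs_of_pos (pow_pos hRpos n)]
    have hω0 : 0 ≤ ω := ENNReal.toReal_nonneg
    have hNm : N R ≤ N R0 := by
      simp only [hN]
      exact_mod_cast Nat.card_mono (aux_fin lam hinf R0) (fun j (hj : lam j ≤ R) => hj.trans h2)
    have hN0 : 0 ≤ N R := by simp only [hN]; positivity
    have hN1 : 0 ≤ N R0 := by simp only [hN]; positivity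
    have hpw : P * V * ω * R ^ n ≤ P * V * ω * R0 ^ n := by gcongr
    have hpw0 : 0 ≤ P * V * ω * R ^ n := by positivity
    have hnum : |N R - P * V * ω * R ^ n| ≤ N R0 + P * V * ω * R0 ^ n := by
      rw [abs_le]; constructor <;> linarith
    gcongr
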